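/- arXiv:1409.1700 — 2 statements merged into one kernel-verified Lean document; each statement's English description precedes it below -/
import Mathlib

section
/- Let d ≥ 1, let μ be a finite nonnegative Borel measure on ℝ^d, and suppose there exist an integer m ≥ 1, real numbers s > 0 and γ ∈ (0,1) with γ < s < m, and a constant K > 0 such that |∫_{ℝ^d} Δ_h^m φ(x) μ(dx)| ≤ K |h|^s ‖φ‖_{C^γ_b} for every φ ∈ C^γ_b(ℝ^d) and every h ∈ ℝ^d with |h| ≤ 1. Then μ is absolutely continuous with respect to Lebesgue measure on ℝ^d, with density f_μ ∈ L¹(ℝ^d), and for every r with 0 < r < s − γ there exists a constant c = c(d, m, s, γ, r) > 0, independent of μ and K, such that ‖f_μ‖_{B^r_{1,∞}} ≤ c (μ(ℝ^d) + K). -/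
open MeasureTheory Real

noncomputable section

/-- The `n`-th finite difference `Δ_h^n f (x) = ∑_{j=0}^n (-1)^{n-j} binom(n,j) f(x + j h)`. -/
def finDiff {d : ℕ} (n : ℕ) (h : EuclideanSpace ℝ (Fin d))
    (f : EuclideanSpace ℝ (Fin d) → ℝ) (x : EuclideanSpace ℝ (Fin d)) : ℝ :=
  ∑ j ∈ Finset.range (n + 1), (-1 : ℝ) ^ (n - j) * (n.choose j : ℝ) * f (x + (j : ℝ) • h)

open Filter Topology BoundedContinuousFunction

theorem exists_profile (d : ℕ) :
    ∃ (ρ : EuclideanSpace ℝ (Fin d) → ℝ) (Z : ℝ), 0 < Z ∧ Continuous ρ ∧ Integrable ρ ∧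
      ∫ u, ρ u = 1 ∧ (∀ u, 0 ≤ ρ u) ∧ (∀ u, 1 < ‖u‖ → ρ u = 0) ∧
      ∀ u v, |ρ u - ρ v| ≤ Z⁻¹ * ‖u - v‖ := by
  set ρ₀ : EuclideanSpace ℝ (Fin d) → ℝ := fun u => max (1 - ‖u‖) 0 with hρ₀
  have hc : Continuous ρ₀ := by fun_prop
  have hz : ∀ u, 1 < ‖u‖ → ρ₀ u = 0 := fun u hu => by
    simp only [hρ₀]; exact max_eq_right (by linarith)
  have hcs : HasCompactSupport ρ₀ := by
    refine HasCompactSupport.intro (isCompact_closedBall (0 : EuclideanSpace ℝ (Fin d)) 1) ?_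
    intro x hx
    apply hz
    simpa using hx
  have hnn : ∀ u, 0 ≤ ρ₀ u := fun u => le_max_right _ _
  have hi : Integrable ρ₀ := hc.integrable_of_hasCompactSupport hcs
  set Z := ∫ u, ρ₀ u with hZ
  have hZpos : 0 < Z := by
    refine hc.integral_pos_of_hasCompactSupport_nonneg_nonzero hcs hnn (x := 0) ?_
    simp [hρ₀]
  set ρ : EuclideanSpace ℝ (Fin d) → ℝ := fun u => Z⁻¹ * ρ₀ u with hρ
  have hρc : Continuous ρ := by fun_prop
  have hρi : Integrable ρ := hi.const_mul _
  have hρ1 : ∫ u, ρ u = 1 := by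
    simp only [hρ]; rw [integral_const_mul, ← hZ]; field_simp
  have hρnn : ∀ u, 0 ≤ ρ u := fun u => mul_nonneg (by positivity) (hnn u)
  have hρz : ∀ u, 1 < ‖u‖ → ρ u = 0 := fun u hu => by simp [hρ, hz u hu]
  have hlip : ∀ u v, |ρ u - ρ v| ≤ Z⁻¹ * ‖u - v‖ := by
    intro u v
    have h1 : |ρ₀ u - ρ₀ v| ≤ ‖u - v‖ := by
      refine (abs_max_sub_max_le_abs _ _ _).trans ?_
      have : (1 - ‖u‖) - (1 - ‖v‖) = ‖v‖ - ‖u‖ := by ring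
      rw [this, norm_sub_rev]
      exact abs_norm_sub_norm_le v u
    simp only [hρ]
    rw [← mul_sub, abs_mul, abs_of_pos (inv_pos.mpr hZpos)]
    gcongr
  exact ⟨ρ, Z, hZpos, hρc, hρi, hρ1, hρnn, hρz, hlip⟩

theorem exists_kernel (d : ℕ) (γ : ℝ) (hγ0 : 0 < γ) (hγ1 : γ < 1) :
    ∃ ν : Measure (EuclideanSpace ℝ (Fin d)), IsProbabilityMeasure ν ∧ ν ≪ volume ∧
      (∀ᵐ u ∂ν, ‖u‖ ≤ 1) ∧ ∃ C : ℝ, 0 ≤ C ∧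
        ∀ (g : EuclideanSpace ℝ (Fin d) →ᵇ ℝ) (z : EuclideanSpace ℝ (Fin d)),
          |(∫ u, g u ∂ν) - ∫ u, g (u + z) ∂ν| ≤ C * ‖z‖ ^ γ * ‖g‖ := by
  obtain ⟨ρ, Z, hZpos, hρc, hρi, hρ1, hρnn, hρz, hlip⟩ := exists_profile d
  -- the translation modulus
  set V := (volume (Metric.closedBall (0 : EuclideanSpace ℝ (Fin d)) 2)).toReal with hV
  have hmod : ∀ z, ∫ u, |ρ u - ρ (u - z)| ≤ (Z⁻¹ * V + 2) * ‖z‖ ^ γ := by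
    intro z
    have hiz : Integrable (fun u => ρ (u - z)) := hρi.comp_sub_right z
    have hdi : Integrable (fun u => |ρ u - ρ (u - z)|) := (hρi.sub hiz).abs
    have hai : Integrable (fun u => ρ u + ρ (u - z)) := hρi.add hiz
    have hV0 : 0 ≤ V := ENNReal.toReal_nonneg
    have hzγ : 0 ≤ ‖z‖ ^ γ := by positivity
    rcases le_total ‖z‖ 1 with h1 | h1
    · have hle : ∫ u, |ρ u - ρ (u - z)| ≤
          ∫ u, (Metric.closedBall (0 : EuclideanSpace ℝ (Fin d)) 2).indicator
            (fun _ => Z⁻¹ * ‖z‖) u := by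
        apply integral_mono hdi
        · refine (integrable_indicator_iff Metric.isClosed_closedBall.measurableSet).2 ?_
          exact integrableOn_const (isCompact_closedBall _ _).measure_lt_top.ne
        · intro u
          by_cases hu : u ∈ Metric.closedBall (0 : EuclideanSpace ℝ (Fin d)) 2
          · simp only [Set.indicator_of_mem hu]
            simpa using hlip u (u - z)
          · simp only [Set.indicator_of_notMem hu]
            have hu' : 2 < ‖u‖ := by simpa using hu
            rw [hρz u (by linarith), hρz (u - z) (by have := norm_sub_norm_le u z; linarith)]
            simp
      rw [integral_indicator Metric.isClosed_closedBall.measurableSet, setIntegral_const] at hle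
      have hzz : ‖z‖ ≤ ‖z‖ ^ γ := by
        conv_lhs => rw [← Real.rpow_one ‖z‖]
        exact Real.rpow_le_rpow_of_exponent_ge' (norm_nonneg _) h1 hγ0.le hγ1.le
      refine hle.trans ?_
      simp only [smul_eq_mul, Measure.real]
      rw [← hV]
      calc V * (Z⁻¹ * ‖z‖) = Z⁻¹ * V * ‖z‖ := by ring
        _ ≤ Z⁻¹ * V * ‖z‖ ^ γ := by gcongr
        _ ≤ _ := by gcongr; linarith
    · have hle : ∫ u, |ρ u - ρ (u - z)| ≤ ∫ u, (ρ u + ρ (u - z)) := by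
        apply integral_mono hdi hai
        intro u
        have a := hρnn u
        have b := hρnn (u - z)
        simp only
        rw [abs_le]; constructor <;> linarith
      rw [integral_add hρi hiz, integral_sub_right_eq_self ρ z, hρ1] at hle
      have : 1 ≤ ‖z‖ ^ γ := Real.one_le_rpow h1 hγ0.le
      have : 0 ≤ Z⁻¹ * V := by positivity
      nlinarith
  have hint : ∀ g : EuclideanSpace ℝ (Fin d) → ℝ,
      ∫ u, g u ∂(volume.withDensity (fun u => ENNReal.ofReal (ρ u))) = ∫ u, ρ u * g u := by
    intro g
    rw [integral_withDensity_eq_integral_toReal_smul (by fun_prop) (by simp)]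
    simp [ENNReal.toReal_ofReal, hρnn]
  refine ⟨volume.withDensity (fun u => ENNReal.ofReal (ρ u)), ⟨?_⟩,
    withDensity_absolutelyContinuous _ _, ?_, Z⁻¹ * V + 2, by positivity, ?_⟩
  · rw [withDensity_apply _ MeasurableSet.univ, setLIntegral_univ,
      ← ofReal_integral_eq_lintegral_ofReal hρi (ae_of_all _ hρnn), hρ1, ENNReal.ofReal_one]
  · rw [ae_withDensity_iff (by fun_prop)]
    refine ae_of_all _ fun u hu => ?_
    by_contra h
    exact hu (by simp [hρz u (not_le.mp h)])
  · intro g z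
    rw [hint, hint (fun u => g (u + z))]
    have e : ∫ u, ρ u * g (u + z) = ∫ u, ρ (u - z) * g u := by
      rw [← integral_add_right_eq_self (fun u => ρ (u - z) * g u) z]
      simp
    have hiz : Integrable (fun u => ρ (u - z)) := hρi.comp_sub_right z
    have hdi : Integrable (fun u => |ρ u - ρ (u - z)|) := (hρi.sub hiz).abs
    have hb : ∀ᵐ u ∂(volume : Measure (EuclideanSpace ℝ (Fin d))), ‖g u‖ ≤ ‖g‖ :=
      ae_of_all _ g.norm_coe_le_norm
    have gm : AEStronglyMeasurable (fun u => g u)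
      (volume : Measure (EuclideanSpace ℝ (Fin d))) := g.continuous.aestronglyMeasurable
    rw [e, ← integral_sub (hρi.mul_bdd gm hb) (hiz.mul_bdd gm hb)]
    have hdd : Integrable (fun u => |ρ u * g u - ρ (u - z) * g u|) :=
      ((hρi.mul_bdd gm hb).sub (hiz.mul_bdd gm hb)).abs
    calc |∫ u, ρ u * g u - ρ (u - z) * g u|
        ≤ ∫ u, |ρ u * g u - ρ (u - z) * g u| := abs_integral_le_integral_abs
      _ ≤ ∫ u, |ρ u - ρ (u - z)| * ‖g‖ := by
          apply integral_mono hdd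
            (hdi.mul_const _)
          intro u
          simp only
          rw [← sub_mul, abs_mul]
          exact mul_le_mul_of_nonneg_left (g.norm_coe_le_norm u) (abs_nonneg _)
      _ ≤ _ := by
          rw [integral_mul_const]
          exact mul_le_mul_of_nonneg_right (hmod z) (norm_nonneg _)

/-- Duality: the `L¹` norm is controlled by testing against bounded continuous functions. -/
theorem integral_abs_le_of_test {d : ℕ} (F : EuclideanSpace ℝ (Fin d) → ℝ) (hF : Integrable F)
    (C : ℝ) (hC : ∀ g : EuclideanSpace ℝ (Fin d) →ᵇ ℝ, ‖g‖ ≤ 1 → |∫ x, g x * F x| ≤ C) :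
    ∫ x, |F x| ≤ C := by
  apply le_of_forall_pos_le_add
  intro ε hε
  obtain ⟨G, -, hG, hGc, hGi⟩ := hF.exists_hasCompactSupport_integral_sub_le (half_pos hε)
  simp only [Real.norm_eq_abs] at hG
  have hFG : Integrable (fun x => F x - G x) := hF.sub hGi
  have hb : ∀ n : ℕ, ∀ x, |(n * G x) / (1 + n * |G x|)| ≤ 1 := by
    intro n x
    rw [abs_div, abs_mul, Nat.abs_cast, abs_of_pos (by positivity : 0 < 1 + n * |G x|),
      div_le_one (by positivity)]
    linarith
  have hcont : ∀ n : ℕ, Continuous fun x => (n * G x) / (1 + n * |G x|) := by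
    intro n
    exact Continuous.div (by fun_prop) (by fun_prop) fun x => by positivity
  have hlim : Tendsto (fun n : ℕ => ∫ x, (n * G x) / (1 + n * |G x|) * G x) atTop
      (𝓝 (∫ x, |G x|)) := by
    refine tendsto_integral_of_dominated_convergence (fun x => |G x|)
      (fun n => ((hcont n).mul hGc).aestronglyMeasurable) hGi.abs ?_ ?_
    · intro n
      refine ae_of_all _ fun x => ?_
      rw [Real.norm_eq_abs, abs_mul]
      have := mul_le_mul_of_nonneg_right (hb n x) (abs_nonneg (G x))
      linarith
    · refine ae_of_all _ fun x => ?_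
      by_cases hx : G x = 0
      · simp [hx]
      have hx' : 0 < |G x| := abs_pos.mpr hx
      have h1 : Tendsto (fun n : ℕ => (1 + n * |G x|)⁻¹) atTop (𝓝 0) := by
        apply Tendsto.inv_tendsto_atTop
        exact tendsto_atTop_add_const_left _ _
          (tendsto_natCast_atTop_atTop.atTop_mul_const hx')
      have h2 : Tendsto (fun n : ℕ => |G x| * (1 - (1 + n * |G x|)⁻¹)) atTop
          (𝓝 (|G x| * (1 - 0))) := (h1.const_sub 1).const_mul _
      rw [sub_zero, mul_one] at h2
      refine h2.congr fun n => ?_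
      have : 0 < 1 + n * |G x| := by positivity
      field_simp
      rw [← sq_abs (G x)]; ring
  have hle : ∫ x, |G x| ≤ C + ε / 2 := by
    refine le_of_tendsto' hlim fun n => ?_
    set g : EuclideanSpace ℝ (Fin d) →ᵇ ℝ :=
      BoundedContinuousFunction.ofNormedAddCommGroup _ (hcont n) 1 (hb n) with hg
    have hgn : ‖g‖ ≤ 1 := BoundedContinuousFunction.norm_ofNormedAddCommGroup_le _ zero_le_one _
    have gm : AEStronglyMeasurable (fun u => g u)
      (volume : Measure (EuclideanSpace ℝ (Fin d))) := g.continuous.aestronglyMeasurable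
    have gb : ∀ᵐ u ∂(volume : Measure (EuclideanSpace ℝ (Fin d))), ‖g u‖ ≤ 1 :=
      ae_of_all _ (hb n)
    have e : ∫ x, (n * G x) / (1 + n * |G x|) * G x = (∫ x, g x * F x) - ∫ x, g x * (F x - G x) := by
      rw [← integral_sub (hF.bdd_mul gm gb) (hFG.bdd_mul gm gb)]
      congr 1; ext x
      have : g x = (n * G x) / (1 + n * |G x|) := rfl
      rw [this]; ring
    have e2 : |∫ x, g x * (F x - G x)| ≤ ε / 2 := by
      refine abs_integral_le_integral_abs.trans (le_trans ?_ hG)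
      apply integral_mono (hFG.bdd_mul gm gb).abs hFG.abs
      intro x
      simp only [abs_mul]
      have := mul_le_mul_of_nonneg_right (hb n x) (abs_nonneg (F x - G x))
      rw [one_mul] at this
      exact this
    have := hC g hgn
    rw [e]
    have a := le_abs_self (∫ x, g x * F x)
    have b := neg_abs_le (∫ x, g x * (F x - G x))
    linarith
  have : ∫ x, |F x| ≤ ∫ x, (|F x - G x| + |G x|) := by
    apply integral_mono hF.abs (hFG.abs.add hGi.abs)
    intro x
    have := abs_add_le (F x - G x) (G x)
    simpa using this
  rw [integral_add hFG.abs hGi.abs] at this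
  linarith

/-- Translation operator on bounded continuous functions. -/
def trOp {d : ℕ} (h : EuclideanSpace ℝ (Fin d)) :
    (EuclideanSpace ℝ (Fin d) →ᵇ ℝ) →ₗ[ℝ] (EuclideanSpace ℝ (Fin d) →ᵇ ℝ) where
  toFun g := g.compContinuous ⟨fun x => x + h, by fun_prop⟩
  map_add' f g := by ext x; simp
  map_smul' c g := by ext x; simp

theorem trOp_apply {d : ℕ} (h : EuclideanSpace ℝ (Fin d)) (g : EuclideanSpace ℝ (Fin d) →ᵇ ℝ)
    (x : EuclideanSpace ℝ (Fin d)) : trOp h g x = g (x + h) := rfl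

theorem bcf_integrable_comp {d : ℕ} (ν : Measure (EuclideanSpace ℝ (Fin d))) [IsFiniteMeasure ν]
    (g : EuclideanSpace ℝ (Fin d) →ᵇ ℝ) (k : EuclideanSpace ℝ (Fin d) → EuclideanSpace ℝ (Fin d))
    (hk : Continuous k) : Integrable (fun u => g (k u)) ν :=
  (g.compContinuous ⟨k, hk⟩).integrable ν

/-- Averaging operator on bounded continuous functions. -/
def avOp {d : ℕ} (ν : Measure (EuclideanSpace ℝ (Fin d))) [IsProbabilityMeasure ν] (a : ℝ) :
    (EuclideanSpace ℝ (Fin d) →ᵇ ℝ) →ₗ[ℝ] (EuclideanSpace ℝ (Fin d) →ᵇ ℝ) where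
  toFun g := BoundedContinuousFunction.ofNormedAddCommGroup
    (fun x => ∫ u, g (x + a • u) ∂ν)
    (continuous_of_dominated (bound := fun _ => ‖g‖)
      (fun x => (bcf_integrable_comp ν g (fun u => x + a • u) (by fun_prop)).aestronglyMeasurable)
      (fun x => ae_of_all _ fun u => g.norm_coe_le_norm _) (integrable_const _)
      (ae_of_all _ fun u => by fun_prop)) ‖g‖
    (fun x => by
      refine (norm_integral_le_of_norm_le_const (ae_of_all _ fun u => g.norm_coe_le_norm _)).trans ?_
      simp)
  map_add' f g := by
    ext x
    exact integral_add (bcf_integrable_comp ν f (fun u => x + a • u) (by fun_prop))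
      (bcf_integrable_comp ν g (fun u => x + a • u) (by fun_prop))
  map_smul' c g := by
    ext x
    exact integral_const_mul c _

theorem avOp_apply {d : ℕ} (ν : Measure (EuclideanSpace ℝ (Fin d))) [IsProbabilityMeasure ν]
    (a : ℝ) (g : EuclideanSpace ℝ (Fin d) →ᵇ ℝ) (x : EuclideanSpace ℝ (Fin d)) :
    avOp ν a g x = ∫ u, g (x + a • u) ∂ν := rfl

theorem avOp_norm {d : ℕ} (ν : Measure (EuclideanSpace ℝ (Fin d))) [IsProbabilityMeasure ν]
    (a : ℝ) (g : EuclideanSpace ℝ (Fin d) →ᵇ ℝ) : ‖avOp ν a g‖ ≤ ‖g‖ :=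
  (BoundedContinuousFunction.norm_le (norm_nonneg _)).2 fun x => by
    rw [avOp_apply]
    refine (norm_integral_le_of_norm_le_const (ae_of_all _ fun u => g.norm_coe_le_norm _)).trans ?_
    simp

theorem trOp_norm {d : ℕ} (h : EuclideanSpace ℝ (Fin d))
    (g : EuclideanSpace ℝ (Fin d) →ᵇ ℝ) : ‖trOp h g‖ ≤ ‖g‖ :=
  (BoundedContinuousFunction.norm_le (norm_nonneg _)).2 fun _ => g.norm_coe_le_norm _

theorem avOp_zero {d : ℕ} (ν : Measure (EuclideanSpace ℝ (Fin d))) [IsProbabilityMeasure ν] :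
    avOp ν 0 = 1 := by
  ext g x
  rw [avOp_apply]
  simp

theorem commute_tr_av {d : ℕ} (ν : Measure (EuclideanSpace ℝ (Fin d))) [IsProbabilityMeasure ν]
    (a : ℝ) (h : EuclideanSpace ℝ (Fin d)) : Commute (trOp h) (avOp ν a) := by
  ext g x
  simp only [Module.End.mul_apply, trOp_apply, avOp_apply]
  congr 1; ext u; congr 1; abel

theorem integrable_prod_bcf {d : ℕ} (μ ν : Measure (EuclideanSpace ℝ (Fin d))) [IsFiniteMeasure μ]
    [IsFiniteMeasure ν] (g : EuclideanSpace ℝ (Fin d) →ᵇ ℝ)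
    (k : EuclideanSpace ℝ (Fin d) × EuclideanSpace ℝ (Fin d) → EuclideanSpace ℝ (Fin d))
    (hk : Continuous k) : Integrable (fun p => g (k p)) (μ.prod ν) :=
  (g.compContinuous ⟨k, hk⟩).integrable _

theorem commute_av_av {d : ℕ} (ν : Measure (EuclideanSpace ℝ (Fin d))) [IsProbabilityMeasure ν]
    (a b : ℝ) : Commute (avOp ν a) (avOp ν b) := by
  ext g x
  simp only [Module.End.mul_apply, avOp_apply]
  rw [integral_integral_swap]
  · congr 1; ext u; congr 1; ext v; congr 1; abel
  · exact integrable_prod_bcf ν ν g (fun p => x + a • p.1 + b • p.2) (by fun_prop)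

/-- The weights of the finite difference. -/
def wt (m j : ℕ) : ℝ := (-1 : ℝ) ^ (m - j) * (m.choose j : ℝ)

theorem wt_sum (m : ℕ) (hm : 1 ≤ m) : ∑ j ∈ Finset.range (m + 1), wt m j = 0 := by
  have := add_pow (1 : ℝ) (-1) m
  simp only [one_pow, one_mul] at this
  rw [add_neg_cancel, zero_pow (by omega)] at this
  exact this.symm

theorem wt_zero (m : ℕ) : wt m 0 = (-1) ^ m := by simp [wt]

/-- Finite difference operator. -/
def fdOp {d : ℕ} (m : ℕ) (h : EuclideanSpace ℝ (Fin d)) :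
    Module.End ℝ (EuclideanSpace ℝ (Fin d) →ᵇ ℝ) :=
  ∑ j ∈ Finset.range (m + 1), wt m j • trOp ((j : ℝ) • h)

/-- Averaged finite difference operator. -/
def dOp {d : ℕ} (m : ℕ) (ν : Measure (EuclideanSpace ℝ (Fin d))) [IsProbabilityMeasure ν] (a : ℝ) :
    Module.End ℝ (EuclideanSpace ℝ (Fin d) →ᵇ ℝ) :=
  ∑ j ∈ Finset.range (m + 1), wt m j • avOp ν ((j : ℝ) * a)

theorem sum_bcf_apply {d : ℕ} (s : Finset ℕ) (F : ℕ → EuclideanSpace ℝ (Fin d) →ᵇ ℝ)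
    (x : EuclideanSpace ℝ (Fin d)) : (∑ j ∈ s, F j) x = ∑ j ∈ s, F j x := by
  simp

theorem fdOp_apply {d : ℕ} (m : ℕ) (h : EuclideanSpace ℝ (Fin d))
    (g : EuclideanSpace ℝ (Fin d) →ᵇ ℝ) (x : EuclideanSpace ℝ (Fin d)) :
    fdOp m h g x = finDiff m h g x := by
  simp only [fdOp, finDiff, LinearMap.sum_apply, LinearMap.smul_apply, sum_bcf_apply,
    BoundedContinuousFunction.coe_smul, trOp_apply, smul_eq_mul, wt]

theorem dOp_eq {d : ℕ} (m : ℕ) (ν : Measure (EuclideanSpace ℝ (Fin d))) [IsProbabilityMeasure ν]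
    (a : ℝ) (g : EuclideanSpace ℝ (Fin d) →ᵇ ℝ) :
    dOp m ν a g = ∑ j ∈ Finset.range (m + 1), wt m j • avOp ν ((j : ℝ) * a) g := by
  simp only [dOp, LinearMap.sum_apply, LinearMap.smul_apply]

theorem fdOp_eq {d : ℕ} (m : ℕ) (h : EuclideanSpace ℝ (Fin d))
    (g : EuclideanSpace ℝ (Fin d) →ᵇ ℝ) :
    fdOp m h g = ∑ j ∈ Finset.range (m + 1), wt m j • trOp ((j : ℝ) • h) g := by
  simp only [fdOp, LinearMap.sum_apply, LinearMap.smul_apply]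

theorem commute_d_d {d : ℕ} (m : ℕ) (ν : Measure (EuclideanSpace ℝ (Fin d)))
    [IsProbabilityMeasure ν] (a b : ℝ) : Commute (dOp m ν a) (dOp m ν b) := by
  refine Commute.sum_left _ _ _ fun i _ => Commute.sum_right _ _ _ fun j _ => ?_
  exact ((commute_av_av ν _ _).smul_left _).smul_right _

theorem commute_fd_d {d : ℕ} (m : ℕ) (ν : Measure (EuclideanSpace ℝ (Fin d)))
    [IsProbabilityMeasure ν] (h : EuclideanSpace ℝ (Fin d)) (b : ℝ) :
    Commute (fdOp m h) (dOp m ν b) := by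
  refine Commute.sum_left _ _ _ fun i _ => Commute.sum_right _ _ _ fun j _ => ?_
  exact ((commute_tr_av ν _ _).smul_left _).smul_right _

/-- Sum of the absolute values of the weights. -/
def wS (m : ℕ) : ℝ := ∑ j ∈ Finset.range (m + 1), |wt m j|

theorem wS_nonneg (m : ℕ) : 0 ≤ wS m := Finset.sum_nonneg fun _ _ => abs_nonneg _

theorem fdOp_norm {d : ℕ} (m : ℕ) (h : EuclideanSpace ℝ (Fin d))
    (g : EuclideanSpace ℝ (Fin d) →ᵇ ℝ) : ‖fdOp m h g‖ ≤ wS m * ‖g‖ := by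
  rw [fdOp_eq, wS, Finset.sum_mul]
  refine (norm_sum_le _ _).trans (Finset.sum_le_sum fun j _ => ?_)
  rw [norm_smul, Real.norm_eq_abs]
  exact mul_le_mul_of_nonneg_left (trOp_norm _ _) (abs_nonneg _)

theorem wt_integral {d : ℕ} (μ : Measure (EuclideanSpace ℝ (Fin d))) [IsFiniteMeasure μ] (m : ℕ)
    (F : ℕ → EuclideanSpace ℝ (Fin d) →ᵇ ℝ) :
    ∫ x, (∑ j ∈ Finset.range (m + 1), wt m j • F j) x ∂μ =
      ∑ j ∈ Finset.range (m + 1), wt m j * ∫ x, F j x ∂μ := by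
  simp only [sum_bcf_apply, BoundedContinuousFunction.coe_smul, smul_eq_mul]
  rw [integral_finsetSum _ fun j _ => ((F j).integrable μ).const_mul _]
  simp only [integral_const_mul]

/-- Fubini for the averaged differences. -/
theorem integral_dOp {d : ℕ} (m : ℕ) (μ ν : Measure (EuclideanSpace ℝ (Fin d)))
    [IsFiniteMeasure μ] [IsProbabilityMeasure ν] (a : ℝ) (g : EuclideanSpace ℝ (Fin d) →ᵇ ℝ) :
    ∫ x, dOp m ν a g x ∂μ = ∫ u, (∫ x, fdOp m (a • u) g x ∂μ) ∂ν := by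
  have hI : ∀ b : ℝ, Integrable (fun p : EuclideanSpace ℝ (Fin d) × EuclideanSpace ℝ (Fin d) =>
      g (p.2 + b • p.1)) (ν.prod μ) := fun b =>
    integrable_prod_bcf ν μ g (fun p => p.2 + b • p.1) (by fun_prop)
  have hI2 : ∀ b : ℝ, Integrable (fun p : EuclideanSpace ℝ (Fin d) × EuclideanSpace ℝ (Fin d) =>
      g (p.1 + b • p.2)) (μ.prod ν) := fun b =>
    integrable_prod_bcf μ ν g (fun p => p.1 + b • p.2) (by fun_prop)
  simp only [dOp_eq, fdOp_eq, wt_integral, trOp_apply, avOp_apply, smul_smul]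
  have hI3 : ∀ b : ℝ, Integrable (fun u => ∫ x, g (x + b • u) ∂μ) ν := fun b =>
    (hI b).integral_prod_left
  rw [integral_finsetSum _ fun (j : ℕ) _ => (hI3 ((j : ℝ) * a)).const_mul (wt m j)]
  refine Finset.sum_congr rfl fun j _ => ?_
  rw [integral_const_mul, integral_integral_swap (hI2 _)]

/-- Convergence of the averaged differences to zero. -/
theorem tendsto_dOp {d : ℕ} (m : ℕ) (hm : 1 ≤ m) (μ ν : Measure (EuclideanSpace ℝ (Fin d)))
    [IsFiniteMeasure μ] [IsProbabilityMeasure ν] (g : EuclideanSpace ℝ (Fin d) →ᵇ ℝ)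
    (a : ℕ → ℝ) (ha : Tendsto a atTop (𝓝 0)) :
    Tendsto (fun n => ∫ x, dOp m ν (a n) g x ∂μ) atTop (𝓝 0) := by
  have key : ∀ j : ℕ, Tendsto (fun n => ∫ x, avOp ν ((j : ℝ) * a n) g x ∂μ) atTop
      (𝓝 (∫ x, g x ∂μ)) := by
    intro j
    refine tendsto_integral_of_dominated_convergence (fun _ => ‖g‖)
      (fun n => (avOp ν _ g).continuous.aestronglyMeasurable) (integrable_const _) ?_ ?_
    · intro n
      exact ae_of_all _ fun x => ((avOp ν _ g).norm_coe_le_norm x).trans (avOp_norm _ _ _)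
    · refine ae_of_all _ fun x => ?_
      have : g x = ∫ u, g x ∂ν := by simp
      rw [this]
      simp only [avOp_apply]
      refine tendsto_integral_of_dominated_convergence (fun _ => ‖g‖)
        (fun n => (bcf_integrable_comp ν g (fun u => x + ((j : ℝ) * a n) • u)
          (by fun_prop)).aestronglyMeasurable) (integrable_const _) ?_ ?_
      · intro n
        exact ae_of_all _ fun u => g.norm_coe_le_norm _
      · refine ae_of_all _ fun u => ?_
        have h1 : Tendsto (fun n => x + ((j : ℝ) * a n) • u) atTop
            (𝓝 (x + ((j : ℝ) * 0) • u)) :=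
          ((ha.const_mul _).smul_const u).const_add x
        simp only [mul_zero, zero_smul, add_zero] at h1
        exact (g.continuous.tendsto x).comp h1
  simp only [dOp_eq, wt_integral]
  have := tendsto_finsetSum (Finset.range (m + 1)) fun j _ => (key j).const_mul (wt m j)
  rw [← Finset.sum_mul, wt_sum m hm, zero_mul] at this
  exact this

/-- The smoothing operator `P`. -/
def pOp {d : ℕ} (m : ℕ) (ν : Measure (EuclideanSpace ℝ (Fin d))) [IsProbabilityMeasure ν] (a : ℝ) :
    Module.End ℝ (EuclideanSpace ℝ (Fin d) →ᵇ ℝ) := 1 - (-1 : ℝ) ^ m • dOp m ν a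

theorem pOp_eq {d : ℕ} (m : ℕ) (ν : Measure (EuclideanSpace ℝ (Fin d))) [IsProbabilityMeasure ν]
    (a : ℝ) (g : EuclideanSpace ℝ (Fin d) →ᵇ ℝ) :
    pOp m ν a g = ∑ j ∈ Finset.range m, (-(-1 : ℝ) ^ m * wt m (j + 1)) •
      avOp ν (((j + 1 : ℕ) : ℝ) * a) g := by
  have h1 : ((-1 : ℝ) ^ m) * (-1) ^ m = 1 := by rw [← mul_pow]; simp
  simp only [pOp, LinearMap.sub_apply, LinearMap.smul_apply, dOp_eq, Module.End.one_apply]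
  rw [Finset.sum_range_succ', wt_zero]
  simp only [Nat.cast_zero, zero_mul, avOp_zero, Module.End.one_apply]
  rw [smul_add, smul_smul, h1, one_smul, sub_add_cancel_right, Finset.smul_sum,
    ← Finset.sum_neg_distrib]
  refine Finset.sum_congr rfl fun j _ => ?_
  rw [smul_smul, neg_mul]; exact (neg_smul _ _).symm

theorem wt_shift_le (m : ℕ) : ∑ j ∈ Finset.range m, |(-(-1 : ℝ) ^ m * wt m (j + 1))| ≤ wS m := by
  rw [wS, Finset.sum_range_succ']
  have : ∀ j, |(-(-1 : ℝ) ^ m * wt m (j + 1))| = |wt m (j + 1)| := by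
    intro j; rw [abs_mul, abs_neg, abs_pow]; simp
  simp only [this]
  linarith [abs_nonneg (wt m 0)]

theorem pOp_norm {d : ℕ} (m : ℕ) (ν : Measure (EuclideanSpace ℝ (Fin d)))
    [IsProbabilityMeasure ν] (a : ℝ) (g : EuclideanSpace ℝ (Fin d) →ᵇ ℝ) :
    ‖pOp m ν a g‖ ≤ wS m * ‖g‖ := by
  rw [pOp_eq]
  refine le_trans ?_ (mul_le_mul_of_nonneg_right (wt_shift_le m) (norm_nonneg g))
  rw [Finset.sum_mul]
  refine (norm_sum_le _ _).trans (Finset.sum_le_sum fun j _ => ?_)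
  rw [norm_smul, Real.norm_eq_abs]
  exact mul_le_mul_of_nonneg_left (avOp_norm _ _ _) (abs_nonneg _)

theorem avOp_holder {d : ℕ} (ν : Measure (EuclideanSpace ℝ (Fin d)))
    [IsProbabilityMeasure ν] (γ C : ℝ)
    (hν : ∀ (g : EuclideanSpace ℝ (Fin d) →ᵇ ℝ) (z : EuclideanSpace ℝ (Fin d)),
          |(∫ u, g u ∂ν) - ∫ u, g (u + z) ∂ν| ≤ C * ‖z‖ ^ γ * ‖g‖)
    (hC : 0 ≤ C) (a : ℝ) (ha : 0 < a) (g : EuclideanSpace ℝ (Fin d) →ᵇ ℝ)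
    (x y : EuclideanSpace ℝ (Fin d)) :
    |avOp ν a g x - avOp ν a g y| ≤ C * a ^ (-γ) * ‖g‖ * ‖x - y‖ ^ γ := by
  set G : EuclideanSpace ℝ (Fin d) →ᵇ ℝ :=
    g.compContinuous ⟨fun u => x + a • u, by fun_prop⟩ with hG
  have hGn : ‖G‖ ≤ ‖g‖ :=
    (BoundedContinuousFunction.norm_le (norm_nonneg _)).2 fun x => g.norm_coe_le_norm _
  have h := hν G (a⁻¹ • (y - x))
  have e1 : avOp ν a g x = ∫ u, G u ∂ν := rfl
  have e2 : avOp ν a g y = ∫ u, G (u + a⁻¹ • (y - x)) ∂ν := by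
    rw [avOp_apply]
    congr 1; ext u
    change _ = g (x + a • (u + a⁻¹ • (y - x)))
    rw [smul_add, smul_smul, mul_inv_cancel₀ ha.ne', one_smul]
    congr 1; abel
  rw [e1, e2]
  refine h.trans ?_
  rw [norm_smul, norm_inv, Real.norm_of_nonneg ha.le, norm_sub_rev y x,
    Real.mul_rpow (by positivity) (norm_nonneg _), Real.inv_rpow ha.le, ← Real.rpow_neg ha.le]
  calc C * (a ^ (-γ) * ‖x - y‖ ^ γ) * ‖G‖ ≤ C * (a ^ (-γ) * ‖x - y‖ ^ γ) * ‖g‖ := by gcongr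
    _ = _ := by ring

theorem pOp_holder {d : ℕ} (m : ℕ) (ν : Measure (EuclideanSpace ℝ (Fin d)))
    [IsProbabilityMeasure ν] (γ C : ℝ) (hγ : 0 < γ)
    (hν : ∀ (g : EuclideanSpace ℝ (Fin d) →ᵇ ℝ) (z : EuclideanSpace ℝ (Fin d)),
          |(∫ u, g u ∂ν) - ∫ u, g (u + z) ∂ν| ≤ C * ‖z‖ ^ γ * ‖g‖)
    (hC : 0 ≤ C) (a : ℝ) (ha : 0 < a) (g : EuclideanSpace ℝ (Fin d) →ᵇ ℝ)
    (x y : EuclideanSpace ℝ (Fin d)) :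
    |pOp m ν a g x - pOp m ν a g y| ≤ wS m * (C * a ^ (-γ) * ‖g‖) * ‖x - y‖ ^ γ := by
  rw [pOp_eq]
  simp only [sum_bcf_apply, BoundedContinuousFunction.coe_smul, smul_eq_mul]
  rw [← Finset.sum_sub_distrib, mul_assoc]
  refine le_trans ?_ (mul_le_mul_of_nonneg_right (wt_shift_le m) (by positivity))
  rw [Finset.sum_mul]
  refine (Finset.abs_sum_le_sum_abs _ _).trans (Finset.sum_le_sum fun j _ => ?_)
  rw [← mul_sub, abs_mul]
  refine mul_le_mul_of_nonneg_left ?_ (abs_nonneg _)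
  have hj : (1 : ℝ) ≤ ((j + 1 : ℕ) : ℝ) := by push_cast; linarith [(Nat.cast_nonneg j : (0:ℝ) ≤ j)]
  have hja : a ≤ ((j + 1 : ℕ) : ℝ) * a := by nlinarith
  refine (avOp_holder ν γ C hν hC _ (by linarith) g x y).trans ?_
  have := Real.rpow_le_rpow_of_nonpos ha hja (by linarith : -γ ≤ 0)
  gcongr

/-- The constant of the quantitative estimate. -/
def coreC (m : ℕ) (σ C : ℝ) : ℝ :=
  wS m * (1 + C) * (1 + 3 * (1 + wS m) / (1 - (1 / 2 : ℝ) ^ σ))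

theorem core_bound {d : ℕ} (m : ℕ) (hm : 1 ≤ m) (s γ : ℝ) (hγ0 : 0 < γ) (hγ1 : γ < 1)
    (hγs : γ < s) (μ ν : Measure (EuclideanSpace ℝ (Fin d))) [IsFiniteMeasure μ]
    [IsProbabilityMeasure ν] (hνb : ∀ᵐ u ∂ν, ‖u‖ ≤ 1) (C : ℝ) (hC : 0 ≤ C)
    (hν : ∀ (g : EuclideanSpace ℝ (Fin d) →ᵇ ℝ) (z : EuclideanSpace ℝ (Fin d)),
          |(∫ u, g u ∂ν) - ∫ u, g (u + z) ∂ν| ≤ C * ‖z‖ ^ γ * ‖g‖)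
    (K : ℝ) (hK : 0 < K)
    (hyp : ∀ (φ : EuclideanSpace ℝ (Fin d) →ᵇ ℝ) (L : ℝ),
      (∀ x y, |φ x - φ y| ≤ L * ‖x - y‖ ^ γ) →
      ∀ h : EuclideanSpace ℝ (Fin d), ‖h‖ ≤ 1 →
        |∫ x, fdOp m h φ x ∂μ| ≤ K * ‖h‖ ^ s * (‖φ‖ + L)) :
    (∀ (g : EuclideanSpace ℝ (Fin d) →ᵇ ℝ) (δ : ℝ), 0 < δ → δ ≤ 1 →
      |∫ x, dOp m ν δ g x ∂μ| ≤ coreC m (s - γ) C * K * δ ^ (s - γ) * ‖g‖) ∧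
    (∀ (g : EuclideanSpace ℝ (Fin d) →ᵇ ℝ) (h : EuclideanSpace ℝ (Fin d)), 0 < ‖h‖ → ‖h‖ ≤ 1 →
      |∫ x, fdOp m h g x ∂μ| ≤ coreC m (s - γ) C * K * ‖h‖ ^ (s - γ) * ‖g‖) := by
  have hs : 0 < s := hγ0.trans hγs
  have hw := wS_nonneg m
  set B := wS m * (1 + C) with hB
  have hB0 : 0 ≤ B := by positivity
  have hP : ∀ (g : EuclideanSpace ℝ (Fin d) →ᵇ ℝ) (η : ℝ), 0 < η → η ≤ 1 →
      ‖pOp m ν η g‖ + wS m * (C * η ^ (-γ) * ‖g‖) ≤ B * η ^ (-γ) * ‖g‖ := by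
    intro g η h0 h1
    have a := pOp_norm m ν η g
    have b : 1 ≤ η ^ (-γ) := Real.one_le_rpow_of_pos_of_le_one_of_nonpos h0 h1 (by linarith)
    have c : wS m * ‖g‖ ≤ wS m * ‖g‖ * η ^ (-γ) := le_mul_of_one_le_right (by positivity) b
    rw [hB]
    nlinarith
  have step1 : ∀ (φ : EuclideanSpace ℝ (Fin d) →ᵇ ℝ) (L : ℝ), 0 ≤ L →
      (∀ x y, |φ x - φ y| ≤ L * ‖x - y‖ ^ γ) → ∀ δ : ℝ, 0 < δ → δ ≤ 1 →
      |∫ x, dOp m ν δ φ x ∂μ| ≤ K * δ ^ s * (‖φ‖ + L) := by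
    intro φ L hL hφ δ h0 h1
    rw [integral_dOp, ← Real.norm_eq_abs]
    have : ∀ᵐ u ∂ν, ‖∫ x, fdOp m (δ • u) φ x ∂μ‖ ≤ K * δ ^ s * (‖φ‖ + L) := by
      filter_upwards [hνb] with u hu
      have hle : ‖δ • u‖ ≤ δ := by
        rw [norm_smul, Real.norm_of_nonneg h0.le]
        exact mul_le_of_le_one_right h0.le hu
      refine (hyp φ L hφ (δ • u) (hle.trans h1)).trans ?_
      have := Real.rpow_le_rpow (norm_nonneg _) hle hs.le
      gcongr
    simpa using norm_integral_le_of_norm_le_const this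
  have step2 : ∀ (g : EuclideanSpace ℝ (Fin d) →ᵇ ℝ) (δ η : ℝ), 0 < δ → δ ≤ 1 → 0 < η → η ≤ 1 →
      |∫ x, dOp m ν δ (pOp m ν η g) x ∂μ| ≤ K * δ ^ s * (B * η ^ (-γ) * ‖g‖) := by
    intro g δ η h0 h1 h2 h3
    refine (step1 (pOp m ν η g) _ (by positivity)
      (pOp_holder m ν γ C hγ0 hν hC η h2 g) δ h0 h1).trans ?_
    have := hP g η h2 h3
    gcongr
  have step3 : ∀ (g : EuclideanSpace ℝ (Fin d) →ᵇ ℝ) (δ η : ℝ), 0 < δ → δ ≤ 1 → 0 < η → η ≤ 1 →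
      |(∫ x, dOp m ν δ g x ∂μ) - ∫ x, dOp m ν η g x ∂μ| ≤
        K * δ ^ s * (B * η ^ (-γ) * ‖g‖) + K * η ^ s * (B * δ ^ (-γ) * ‖g‖) := by
    intro g δ η h0 h1 h2 h3
    have e : dOp m ν δ g - dOp m ν η g =
        dOp m ν δ (pOp m ν η g) - dOp m ν η (pOp m ν δ g) := by
      have hc : dOp m ν δ (dOp m ν η g) = dOp m ν η (dOp m ν δ g) :=
        LinearMap.congr_fun (commute_d_d m ν δ η) g
      simp only [pOp, LinearMap.sub_apply, LinearMap.smul_apply, Module.End.one_apply, map_sub,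
        map_smul, hc]
      abel
    have e2 : (∫ x, dOp m ν δ g x ∂μ) - ∫ x, dOp m ν η g x ∂μ =
        (∫ x, dOp m ν δ (pOp m ν η g) x ∂μ) - ∫ x, dOp m ν η (pOp m ν δ g) x ∂μ := by
      rw [← integral_sub (BoundedContinuousFunction.integrable μ _)
          (BoundedContinuousFunction.integrable μ _),
        ← integral_sub (BoundedContinuousFunction.integrable μ _)
          (BoundedContinuousFunction.integrable μ _)]
      congr 1; ext x
      exact DFunLike.congr_fun e x
    rw [e2]
    exact (abs_sub _ _).trans (add_le_add (step2 g δ η h0 h1 h2 h3) (step2 g η δ h2 h3 h0 h1))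
  set q : ℝ := (1 / 2 : ℝ) ^ (s - γ) with hq
  have hq1 : q < 1 := Real.rpow_lt_one (by norm_num) (by norm_num) (by linarith)
  have hq0 : 0 < 1 - q := by linarith
  have step4 : ∀ (g : EuclideanSpace ℝ (Fin d) →ᵇ ℝ) (δ : ℝ), 0 < δ → δ ≤ 1 →
      |∫ x, dOp m ν δ g x ∂μ| ≤ 3 * K * B * ‖g‖ * δ ^ (s - γ) / (1 - q) := by
    intro g δ h0 h1
    have hlim : Tendsto (fun n : ℕ => δ * (1 / 2 : ℝ) ^ n) atTop (𝓝 0) := by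
      have := (tendsto_pow_atTop_nhds_zero_of_lt_one (by norm_num : (0:ℝ) ≤ 1 / 2)
        (by norm_num)).const_mul δ
      simpa using this
    have hT := tendsto_dOp m hm μ ν g _ hlim
    have := dist_le_of_le_geometric_of_tendsto₀ q (3 * K * B * ‖g‖ * δ ^ (s - γ)) hq1 ?_ hT
    · simpa [Real.dist_eq] using this
    · intro n
      set t := δ * (1 / 2 : ℝ) ^ n with ht
      have ht0 : 0 < t := by positivity
      have ht1 : t ≤ 1 := by
        have : (1 / 2 : ℝ) ^ n ≤ 1 := pow_le_one₀ (by norm_num) (by norm_num)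
        rw [ht]; nlinarith [pow_pos (by norm_num : (0:ℝ) < 1 / 2) n]
      have e : δ * (1 / 2 : ℝ) ^ (n + 1) = t * (1 / 2) := by rw [ht, pow_succ]; ring
      rw [e, Real.dist_eq]
      refine (step3 g t (t * (1 / 2)) ht0 ht1 (by positivity) (by linarith)).trans ?_
      have et : t ^ s * t ^ (-γ) = t ^ (s - γ) := by
        rw [← Real.rpow_add ht0, sub_eq_add_neg]
      have et2 : t ^ (s - γ) = δ ^ (s - γ) * q ^ n := by
        rw [ht, Real.mul_rpow h0.le (by positivity), hq, ← Real.rpow_natCast, ← Real.rpow_natCast,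
          ← Real.rpow_mul (by norm_num), ← Real.rpow_mul (by norm_num), mul_comm (n : ℝ)]
      have a1 : (1 / 2 : ℝ) ^ s ≤ 1 := Real.rpow_le_one (by norm_num) (by norm_num) hs.le
      have a2 : (1 / 2 : ℝ) ^ (-γ) ≤ 2 := by
        have : (1 / 2 : ℝ) ^ (-γ) ≤ (1 / 2 : ℝ) ^ (-1 : ℝ) :=
          Real.rpow_le_rpow_of_exponent_ge (by norm_num) (by norm_num) (by linarith)
        refine this.trans ?_
        rw [Real.rpow_neg_one]; norm_num
      rw [Real.mul_rpow ht0.le (by norm_num), Real.mul_rpow ht0.le (by norm_num)]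
      have hX : 0 ≤ K * B * ‖g‖ * (t ^ s * t ^ (-γ)) := by positivity
      calc _ = K * B * ‖g‖ * (t ^ s * t ^ (-γ)) * ((1 / 2 : ℝ) ^ (-γ) + (1 / 2 : ℝ) ^ s) := by ring
        _ ≤ K * B * ‖g‖ * (t ^ s * t ^ (-γ)) * 3 := by
          apply mul_le_mul_of_nonneg_left _ hX; linarith
        _ = _ := by rw [et, et2]; ring
  have hcoreC : coreC m (s - γ) C = B + 3 * B / (1 - q) + 3 * B * wS m / (1 - q) := by
    rw [coreC, ← hB, ← hq]; ring
  constructor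
  · intro g δ h0 h1
    refine (step4 g δ h0 h1).trans ?_
    have hY : 0 ≤ K * δ ^ (s - γ) * ‖g‖ := by positivity
    calc 3 * K * B * ‖g‖ * δ ^ (s - γ) / (1 - q)
        = (3 * B / (1 - q)) * (K * δ ^ (s - γ) * ‖g‖) := by ring
      _ ≤ coreC m (s - γ) C * (K * δ ^ (s - γ) * ‖g‖) := by
          apply mul_le_mul_of_nonneg_right _ hY
          rw [hcoreC]
          have : 0 ≤ 3 * B * wS m / (1 - q) := by positivity
          linarith
      _ = _ := by ring
  · intro g h h0 h1
    have e : fdOp m h g = fdOp m h (pOp m ν ‖h‖ g) +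
        (-1 : ℝ) ^ m • dOp m ν ‖h‖ (fdOp m h g) := by
      have hc : fdOp m h (dOp m ν ‖h‖ g) = dOp m ν ‖h‖ (fdOp m h g) :=
        LinearMap.congr_fun (commute_fd_d m ν h ‖h‖) g
      simp only [pOp, LinearMap.sub_apply, LinearMap.smul_apply, Module.End.one_apply, map_sub,
        map_smul, hc]
      abel
    have e2 : ∫ x, fdOp m h g x ∂μ = (∫ x, fdOp m h (pOp m ν ‖h‖ g) x ∂μ) +
        (-1 : ℝ) ^ m * ∫ x, dOp m ν ‖h‖ (fdOp m h g) x ∂μ := by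
      rw [← integral_const_mul, ← integral_add (BoundedContinuousFunction.integrable μ _)
          ((BoundedContinuousFunction.integrable μ _).const_mul _)]
      congr 1; ext x
      exact DFunLike.congr_fun e x
    have b1 : |∫ x, fdOp m h (pOp m ν ‖h‖ g) x ∂μ| ≤ K * ‖h‖ ^ s * (B * ‖h‖ ^ (-γ) * ‖g‖) := by
      refine (hyp (pOp m ν ‖h‖ g) _ (pOp_holder m ν γ C hγ0 hν hC ‖h‖ h0 g) h h1).trans ?_
      have := hP g ‖h‖ h0 h1
      gcongr
    have b2 := step4 (fdOp m h g) ‖h‖ h0 h1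
    have b3 : 3 * K * B * ‖fdOp m h g‖ * ‖h‖ ^ (s - γ) / (1 - q) ≤
        3 * K * B * (wS m * ‖g‖) * ‖h‖ ^ (s - γ) / (1 - q) := by
      have := fdOp_norm m h g
      gcongr
    have et : ‖h‖ ^ s * ‖h‖ ^ (-γ) = ‖h‖ ^ (s - γ) := by
      rw [← Real.rpow_add h0, sub_eq_add_neg]
    rw [e2]
    refine (abs_add_le _ _).trans ?_
    rw [abs_mul, abs_pow, abs_neg, abs_one, one_pow, one_mul]
    have hY : 0 ≤ K * ‖h‖ ^ (s - γ) * ‖g‖ := by positivity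
    calc _ ≤ K * ‖h‖ ^ s * (B * ‖h‖ ^ (-γ) * ‖g‖) +
          3 * K * B * (wS m * ‖g‖) * ‖h‖ ^ (s - γ) / (1 - q) := add_le_add b1 (b2.trans b3)
      _ = K * B * ‖g‖ * (‖h‖ ^ s * ‖h‖ ^ (-γ)) +
          3 * K * B * (wS m * ‖g‖) * ‖h‖ ^ (s - γ) / (1 - q) := by ring
      _ = (B + 3 * B * wS m / (1 - q)) * (K * ‖h‖ ^ (s - γ) * ‖g‖) := by rw [et]; ring
      _ ≤ coreC m (s - γ) C * (K * ‖h‖ ^ (s - γ) * ‖g‖) := by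
          apply mul_le_mul_of_nonneg_right _ hY
          rw [hcoreC]
          have : 0 ≤ 3 * B / (1 - q) := by positivity
          linarith
      _ = _ := by ring

theorem ac_of_bound {d : ℕ} (m : ℕ) (hm : 1 ≤ m) (σ : ℝ) (hσ : 0 < σ)
    (μ ν : Measure (EuclideanSpace ℝ (Fin d))) [IsFiniteMeasure μ]
    [IsProbabilityMeasure ν] (hνa : ν ≪ volume) (c : ℝ)
    (hb : ∀ (g : EuclideanSpace ℝ (Fin d) →ᵇ ℝ) (δ : ℝ), 0 < δ → δ ≤ 1 →
      |∫ x, dOp m ν δ g x ∂μ| ≤ c * δ ^ σ * ‖g‖) : μ ≪ volume := by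
  have hcl : ∀ A : Set (EuclideanSpace ℝ (Fin d)), IsClosed A → volume A = 0 → μ A = 0 := by
    intro A hA hA0
    have hpos : ∀ n : ℕ, (0 : ℝ) < 1 / ((n : ℝ) + 1) := fun n => by positivity
    have hT := thickenedIndicator_tendsto_indicator_closure hpos
      tendsto_one_div_add_atTop_nhds_zero_nat A
    rw [hA.closure_eq, tendsto_pi_nhds] at hT
    let g : ℕ → EuclideanSpace ℝ (Fin d) →ᵇ ℝ := fun n =>
      BoundedContinuousFunction.ofNormedAddCommGroup
        (fun x => ((thickenedIndicator (hpos n) A x : NNReal) : ℝ))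
        (by fun_prop) 1
        (fun x => by
          rw [Real.norm_of_nonneg (NNReal.coe_nonneg _)]
          exact_mod_cast thickenedIndicator_le_one (hpos n) A x)
    have hg1 : ∀ n x, ‖g n x‖ ≤ 1 := fun n x => by
      change ‖((thickenedIndicator (hpos n) A x : NNReal) : ℝ)‖ ≤ 1
      rw [Real.norm_of_nonneg (NNReal.coe_nonneg _)]
      exact_mod_cast thickenedIndicator_le_one (hpos n) A x
    have hgn : ∀ n, ‖g n‖ ≤ 1 := fun n =>
      (BoundedContinuousFunction.norm_le zero_le_one).2 (hg1 n)
    have hgT : ∀ x, Tendsto (fun n => g n x) atTop (𝓝 (A.indicator (fun _ => (1 : ℝ)) x)) := by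
      intro x
      have := (NNReal.tendsto_coe).2 (hT x)
      have e : A.indicator (fun _ => (1 : ℝ)) x =
          ((A.indicator (fun _ => (1 : NNReal)) x : NNReal) : ℝ) := by
        by_cases hx : x ∈ A <;> simp [hx]
      rw [e]
      exact this
    have hI : Tendsto (fun n => ∫ x, g n x ∂μ) atTop (𝓝 (μ.real A)) := by
      rw [← integral_indicator_one hA.measurableSet]
      exact tendsto_integral_of_dominated_convergence (fun _ => 1)
        (fun n => (g n).continuous.aestronglyMeasurable) (integrable_const _)
        (fun n => ae_of_all _ (hg1 n)) (ae_of_all _ hgT)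
    have hAv : ∀ a : ℝ, 0 < a → Tendsto (fun n => ∫ x, avOp ν a (g n) x ∂μ) atTop (𝓝 0) := by
      intro a ha
      have h0 : (0 : ℝ) = ∫ x, (0 : ℝ) ∂μ := by simp
      rw [h0]
      refine tendsto_integral_of_dominated_convergence (fun _ => 1)
        (fun n => (avOp ν a (g n)).continuous.aestronglyMeasurable) (integrable_const _)
        (fun n => ae_of_all _ fun x =>
          ((avOp ν a (g n)).norm_coe_le_norm x).trans ((avOp_norm _ _ _).trans (hgn n))) ?_
      refine ae_of_all _ fun x => ?_
      have h0' : (0 : ℝ) = ∫ u, (0 : ℝ) ∂ν := by simp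
      rw [h0']
      simp only [avOp_apply]
      refine tendsto_integral_of_dominated_convergence (fun _ => 1)
        (fun n => (bcf_integrable_comp ν (g n) (fun u => x + a • u)
          (by fun_prop)).aestronglyMeasurable) (integrable_const _)
        (fun n => ae_of_all _ fun u => hg1 n _) ?_
      have hnull : ∀ᵐ u ∂ν, x + a • u ∉ A := by
        refine hνa.ae_le ?_
        change ∀ᵐ u ∂volume, x + a • u ∉ A
        rw [ae_iff]
        simp only [not_not]
        have : {u | x + a • u ∈ A} = (fun u => a • u) ⁻¹' ((fun y => x + y) ⁻¹' A) := rfl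
        rw [this, Measure.addHaar_preimage_smul _ ha.ne', measure_preimage_add, hA0, mul_zero]
      filter_upwards [hnull] with u hu
      have := hgT (x + a • u)
      rwa [Set.indicator_of_notMem hu] at this
    have hD : ∀ δ : ℝ, 0 < δ → Tendsto (fun n => ∫ x, dOp m ν δ (g n) x ∂μ) atTop
        (𝓝 ((-1) ^ m * μ.real A)) := by
      intro δ h0
      simp only [dOp_eq, wt_integral]
      simp only [Finset.sum_range_succ', wt_zero, Nat.cast_zero, zero_mul, avOp_zero,
        Module.End.one_apply]
      have h1 := tendsto_finsetSum (Finset.range m) fun j _ =>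
        (hAv (((j + 1 : ℕ) : ℝ) * δ) (by positivity)).const_mul (wt m (j + 1))
      have h2 := h1.add (hI.const_mul ((-1 : ℝ) ^ m))
      simpa using h2
    have hle : ∀ δ : ℝ, 0 < δ → δ ≤ 1 → μ.real A ≤ |c| * δ ^ σ := by
      intro δ h0 h1
      have h2 := (hD δ h0).abs
      rw [abs_mul, abs_pow, abs_neg, abs_one, one_pow, one_mul,
        abs_of_nonneg measureReal_nonneg] at h2
      refine le_of_tendsto' h2 fun n => (hb (g n) δ h0 h1).trans ?_
      have hd : 0 ≤ δ ^ σ := by positivity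
      calc c * δ ^ σ * ‖g n‖ ≤ |c| * δ ^ σ * ‖g n‖ := by gcongr; exact le_abs_self c
        _ ≤ |c| * δ ^ σ * 1 := by gcongr; exact hgn n
        _ = _ := mul_one _
    have hz : μ.real A ≤ 0 := by
      have ht : Tendsto (fun δ : ℝ => |c| * δ ^ σ) (𝓝[>] 0) (𝓝 (|c| * 0 ^ σ)) := by
        refine Tendsto.const_mul _ ?_
        exact ((Real.continuousAt_rpow_const 0 σ (Or.inr hσ.le)).tendsto).mono_left
          nhdsWithin_le_nhds
      rw [Real.zero_rpow hσ.ne', mul_zero] at ht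
      refine ge_of_tendsto ht ?_
      filter_upwards [Ioc_mem_nhdsGT (zero_lt_one' ℝ)] with δ hδ using hle δ hδ.1 hδ.2
    exact (measureReal_eq_zero_iff).1 (le_antisymm hz measureReal_nonneg)
  refine Measure.AbsolutelyContinuous.mk fun A hA hA0 => ?_
  rw [hA.measure_eq_iSup_isClosed_of_ne_top (measure_ne_top μ A)]
  simp only [ENNReal.iSup_eq_zero]
  intro F hF hFc
  exact hcl F hFc (measure_mono_null hF hA0)

/-- **Smoothing lemma.** If a finite nonnegative Borel measure `μ` on `ℝ^d` satisfies
`|∫ Δ_h^m φ dμ| ≤ K |h|^s ‖φ‖_{C^γ_b}` for all `φ ∈ C^γ_b(ℝ^d)` and `|h| ≤ 1`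
(with `0 < γ < 1`, `γ < s < m`, `K > 0`), then `μ` has a density `f ∈ L¹` with respect to
Lebesgue measure, and for every `0 < r < s - γ` there is a constant `c = c(d,m,s,γ,r)`,
independent of `μ` and `K`, with `‖f‖_{B^r_{1,∞}} ≤ c (μ(ℝ^d) + K)`.
Here the `B^r_{1,∞}` norm is encoded by the requirement that
`‖f‖_{L¹} + |h|^{-r} ‖Δ_h^m f‖_{L¹} ≤ c (μ(ℝ^d) + K)` for all `0 < |h| ≤ 1`, and the
`C^γ_b` norm by quantifying over bounds `M` for `sup|φ|` and `L` for the `γ`-Hölder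
seminorm of `φ`. -/
theorem smoothing_lemma (d m : ℕ) (hd : 1 ≤ d) (hm : 1 ≤ m) (s γ r : ℝ)
    (hs : 0 < s) (hγ0 : 0 < γ) (hγ1 : γ < 1) (hγs : γ < s) (hsm : s < (m : ℝ))
    (hr0 : 0 < r) (hr : r < s - γ) :
    ∃ c : ℝ, 0 < c ∧
      ∀ (μ : Measure (EuclideanSpace ℝ (Fin d))), IsFiniteMeasure μ →
      ∀ (K : ℝ), 0 < K →
      (∀ (φ : EuclideanSpace ℝ (Fin d) → ℝ) (M L : ℝ),
          (∀ x, |φ x| ≤ M) → (∀ x y, |φ x - φ y| ≤ L * ‖x - y‖ ^ γ) →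
          ∀ h : EuclideanSpace ℝ (Fin d), ‖h‖ ≤ 1 →
            |∫ x, finDiff m h φ x ∂μ| ≤ K * ‖h‖ ^ s * (M + L)) →
      ∃ f : EuclideanSpace ℝ (Fin d) → ℝ,
        Integrable f volume ∧ (∀ᵐ x ∂volume, 0 ≤ f x) ∧
        μ = volume.withDensity (fun x => ENNReal.ofReal (f x)) ∧
        ∀ h : EuclideanSpace ℝ (Fin d), 0 < ‖h‖ → ‖h‖ ≤ 1 →
          (∫ x, |f x|) + ‖h‖ ^ (-r) * ∫ x, |finDiff m h f x| ≤
            c * ((μ Set.univ).toReal + K) := by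
  obtain ⟨ν, hνp, hνa, hνb, C, hC, hν⟩ := exists_kernel d γ hγ0 hγ1
  have hq1 : (1 / 2 : ℝ) ^ (s - γ) < 1 :=
    Real.rpow_lt_one (by norm_num) (by norm_num) (by linarith)
  have hq0 : 0 < 1 - (1 / 2 : ℝ) ^ (s - γ) := by linarith
  have hc0 : 0 ≤ coreC m (s - γ) C := by
    have := wS_nonneg m
    unfold coreC
    positivity
  refine ⟨1 + coreC m (s - γ) C, by linarith, ?_⟩
  intro μ hμ K hK hyp
  obtain ⟨hD, hF⟩ := core_bound m hm s γ hγ0 hγ1 hγs μ ν hνb C hC hν K hK (by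
    intro φ L hφ h hh
    have := hyp φ ‖φ‖ L φ.norm_coe_le_norm hφ h hh
    simpa only [fdOp_apply] using this)
  have hac : μ ≪ volume := ac_of_bound m hm (s - γ) (by linarith) μ ν hνa _ hD
  set f : EuclideanSpace ℝ (Fin d) → ℝ := fun x => (μ.rnDeriv volume x).toReal with hf
  have hfi : Integrable f volume := Measure.integrable_toReal_rnDeriv
  have hfn : ∀ x, 0 ≤ f x := fun x => ENNReal.toReal_nonneg
  have htest : ∀ g : EuclideanSpace ℝ (Fin d) → ℝ, ∫ x, f x * g x = ∫ x, g x ∂μ := by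
    intro g
    have := integral_rnDeriv_smul (f := g) hac
    simpa only [smul_eq_mul] using this
  refine ⟨f, hfi, ae_of_all _ hfn, ?_, ?_⟩
  · conv_lhs => rw [← Measure.withDensity_rnDeriv_eq μ volume hac]
    apply withDensity_congr_ae
    filter_upwards [Measure.rnDeriv_lt_top μ volume] with x hx
    rw [hf, ENNReal.ofReal_toReal hx.ne]
  · intro h h0 h1
    have hmass : ∫ x, |f x| = (μ Set.univ).toReal := by
      have := htest (fun _ => 1)
      simp only [mul_one, integral_const, smul_eq_mul, Measure.real] at this
      rw [← this]
      congr 1; ext x; exact abs_of_nonneg (hfn x)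
    have hshift : ∀ j : ℕ, Integrable (fun x => f (x + (j : ℝ) • h)) volume := fun j =>
      hfi.comp_add_right _
    have hfd : Integrable (fun x => finDiff m h f x) volume := by
      unfold finDiff
      exact integrable_finsetSum _ fun j _ => (hshift j).const_mul _
    have hL1 : ∫ x, |finDiff m h f x| ≤ coreC m (s - γ) C * K * ‖h‖ ^ (s - γ) := by
      apply integral_abs_le_of_test _ hfd
      intro g hg
      have gm : AEStronglyMeasurable (fun u => g u)
        (volume : Measure (EuclideanSpace ℝ (Fin d))) := g.continuous.aestronglyMeasurable
      have gb : ∀ᵐ u ∂(volume : Measure (EuclideanSpace ℝ (Fin d))), ‖g u‖ ≤ ‖g‖ :=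
        ae_of_all _ g.norm_coe_le_norm
      have e : ∫ x, g x * finDiff m h f x = ∫ x, fdOp m (-h) g x ∂μ := by
        have e1 : ∀ x, g x * finDiff m h f x =
            ∑ j ∈ Finset.range (m + 1), wt m j * (g x * f (x + (j : ℝ) • h)) := by
          intro x
          rw [finDiff, Finset.mul_sum]
          refine Finset.sum_congr rfl fun j _ => ?_
          rw [wt]; ring
        simp only [e1]
        rw [integral_finsetSum _ fun (j : ℕ) _ => ((hshift j).bdd_mul gm gb).const_mul (wt m j),
          fdOp_eq, wt_integral]
        refine Finset.sum_congr rfl fun j _ => ?_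
        rw [integral_const_mul, ← htest,
          ← integral_add_right_eq_self (fun x => f x * trOp ((j : ℝ) • -h) g x) ((j : ℝ) • h)]
        congr 2; ext x
        rw [trOp_apply, smul_neg, add_neg_cancel_right, mul_comm]
      rw [e]
      have := hF g (-h) (by rwa [norm_neg]) (by rwa [norm_neg])
      rw [norm_neg] at this
      refine this.trans (mul_le_of_le_one_right (by positivity) hg)
    have hrs : ‖h‖ ^ (-r) * ‖h‖ ^ (s - γ) ≤ 1 := by
      rw [← Real.rpow_add h0]
      exact Real.rpow_le_one (norm_nonneg _) h1 (by linarith)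
    have hr1 : 0 ≤ ‖h‖ ^ (-r) := by positivity
    have hM : 0 ≤ (μ Set.univ).toReal := ENNReal.toReal_nonneg
    rw [hmass]
    calc (μ Set.univ).toReal + ‖h‖ ^ (-r) * ∫ x, |finDiff m h f x|
        ≤ (μ Set.univ).toReal + ‖h‖ ^ (-r) * (coreC m (s - γ) C * K * ‖h‖ ^ (s - γ)) := by gcongr
      _ = (μ Set.univ).toReal + coreC m (s - γ) C * K * (‖h‖ ^ (-r) * ‖h‖ ^ (s - γ)) := by ring
      _ ≤ (μ Set.univ).toReal + coreC m (s - γ) C * K * 1 := by gcongr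
      _ ≤ _ := by nlinarith [mul_nonneg hc0 hM]
end
end

section
/- Let (Ω, 𝓕, P) be a probability space and let G, G' : Ω → ℝ be integrable random variables with G > 0 and G' > 0 almost surely and E[G] = E[G']. Then for every measurable X : Ω → ℝ with |X| ≤ 1 almost surely, |E[(G' − G) X]| ≤ 2 E[G' |log(G'/G)|], where the right-hand side is allowed to be +∞. -/
open MeasureTheory

/-- If `G, G' > 0` a.s. are integrable random variables on a probability space with
`E[G] = E[G']`, then for every measurable `X` with `|X| ≤ 1` a.s.,
`|E[(G' − G) X]| ≤ 2 E[G' |log(G'/G)|]`, the right-hand side being possibly `+∞`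
(hence stated with the lower integral in `ℝ≥0∞`). -/
theorem abs_integral_sub_mul_le {Ω : Type*} [MeasurableSpace Ω]
    (P : Measure Ω) [IsProbabilityMeasure P]
    (G G' : Ω → ℝ) (hG : Integrable G P) (hG' : Integrable G' P)
    (hGpos : ∀ᵐ ω ∂P, 0 < G ω) (hG'pos : ∀ᵐ ω ∂P, 0 < G' ω)
    (heq : ∫ ω, G ω ∂P = ∫ ω, G' ω ∂P)
    (X : Ω → ℝ) (hX : Measurable X) (hXb : ∀ᵐ ω ∂P, |X ω| ≤ 1) :
    ENNReal.ofReal |∫ ω, (G' ω - G ω) * X ω ∂P| ≤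
      2 * ∫⁻ ω, ENNReal.ofReal (G' ω * |Real.log (G' ω / G ω)|) ∂P := by
  have hD : Integrable (fun ω => G' ω - G ω) P := hG'.sub hG
  have hM : Integrable (fun ω => max (G' ω - G ω) 0) P := hD.pos_part
  have h0 : ∫ ω, (G' ω - G ω) ∂P = 0 := by
    rw [integral_sub hG' hG, heq, sub_self]
  have h1 : |∫ ω, (G' ω - G ω) * X ω ∂P| ≤ ∫ ω, |G' ω - G ω| ∂P := by
    rw [← Real.norm_eq_abs]
    refine norm_integral_le_of_norm_le hD.abs ?_
    filter_upwards [hXb] with ω hω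
    rw [Real.norm_eq_abs, abs_mul]
    exact mul_le_of_le_one_right (abs_nonneg _) hω
  have h2 : ∫ ω, |G' ω - G ω| ∂P = 2 * ∫ ω, max (G' ω - G ω) 0 ∂P := by
    have h3 : ∀ ω, |G' ω - G ω| = 2 * max (G' ω - G ω) 0 - (G' ω - G ω) := by
      intro ω
      rcases le_total 0 (G' ω - G ω) with h | h
      · rw [abs_of_nonneg h, max_eq_left h]; ring
      · rw [abs_of_nonpos h, max_eq_right h]; ring
    simp_rw [h3]
    rw [integral_sub (hM.const_mul 2) hD, h0, integral_const_mul, sub_zero]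
  calc ENNReal.ofReal |∫ ω, (G' ω - G ω) * X ω ∂P|
      ≤ ENNReal.ofReal (2 * ∫ ω, max (G' ω - G ω) 0 ∂P) :=
        ENNReal.ofReal_le_ofReal (h1.trans h2.le)
    _ = 2 * ∫⁻ ω, ENNReal.ofReal (max (G' ω - G ω) 0) ∂P := by
        rw [ENNReal.ofReal_mul (by norm_num), ofReal_integral_eq_lintegral_ofReal hM
          (Filter.Eventually.of_forall fun ω => le_max_right _ _)]
        simp
    _ ≤ _ := by
        gcongr 2 * ?_
        refine lintegral_mono_ae ?_
        filter_upwards [hGpos, hG'pos] with ω hg hg'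
        refine ENNReal.ofReal_le_ofReal (max_le ?_ (by positivity))
        have h4 := Real.one_sub_inv_le_log_of_pos (div_pos hg' hg)
        have h5 := mul_le_mul_of_nonneg_left (h4.trans (le_abs_self _)) hg'.le
        have h6 : G' ω * (1 - (G' ω / G ω)⁻¹) = G' ω - G ω := by
          field_simp
        linarith
end
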